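/- There is no height ≤ 2 poset P with exactly (10!)² − 1 = 13168189439999 linear extensions. -/

import Mathlib

/-- A linear extension of a finite poset `α` (with `n = |α|`) is an order-preserving
bijection `α ≃ Fin n`. -/
def IsLinearExtension {α : Type*} [PartialOrder α] {n : ℕ} (ℓ : α ≃ Fin n) : Prop :=
  ∀ x y : α, x ≤ y → ℓ x ≤ ℓ y

open Finset

namespace IsLinearExtension

variable {α : Type*} [PartialOrder α] {m : ℕ}

theorem lt {ℓ : α ≃ Fin m} (h : IsLinearExtension ℓ) {x y : α} (hxy : x < y) : ℓ x < ℓ y :=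
  lt_of_le_of_ne (h x y hxy.le) fun e => hxy.ne (ℓ.injective e)

/-- Exchanging two consecutive incomparable elements yields a linear extension. -/
theorem trans_swap {ℓ : α ≃ Fin m} (h : IsLinearExtension ℓ) {i j : Fin m}
    (hij : (i : ℕ) + 1 = j) (hn : ¬ ℓ.symm i < ℓ.symm j) :
    IsLinearExtension (ℓ.trans (Equiv.swap i j)) := by
  intro x y hxy
  rcases hxy.eq_or_lt with rfl | hlt
  · exact le_rfl
  have hpq := h.lt hlt
  have hne : ¬ (ℓ x = i ∧ ℓ y = j) := by
    rintro ⟨rfl, rfl⟩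
    simp [hlt] at hn
  simp only [Equiv.trans_apply, Equiv.swap_apply_def]
  simp only [Fin.ext_iff, Fin.lt_def] at hpq hne
  split_ifs <;> simp only [Fin.ext_iff, Fin.le_def] at * <;> omega

end IsLinearExtension

section

variable {α : Type*} [Fintype α] [PartialOrder α]

open scoped Classical in
/-- The number of linear extensions is congruent modulo 2 to the number of those in which
consecutive positions `i`, `i + 1` with `i % 2 = s`, `i < k` carry comparable elements. -/
theorem odd_card_consecutive_lt {m : ℕ} (s : ℕ)
    (hodd : Odd #{ℓ : α ≃ Fin m | IsLinearExtension ℓ}) (k : ℕ) :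
    Odd #{ℓ : α ≃ Fin m | IsLinearExtension ℓ ∧ ∀ i j : Fin m, (i : ℕ) + 1 = j →
      (i : ℕ) % 2 = s → (i : ℕ) < k → ℓ.symm i < ℓ.symm j} := by
  induction k with
  | zero => simpa using hodd
  | succ k ih =>
    by_cases hk : k % 2 = s ∧ k + 1 < m
    · obtain ⟨hs, hm⟩ := hk
      let a : Fin m := ⟨k, by omega⟩
      let b : Fin m := ⟨k + 1, hm⟩
      have hab : (a : ℕ) + 1 = b := rfl
      rw [← card_filter_add_card_filter_not (fun ℓ : α ≃ Fin m => ℓ.symm a < ℓ.symm b)] at ih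
      simp only [filter_filter] at ih
      rw [Nat.odd_add] at ih
      have hpos : ∀ ℓ : α ≃ Fin m, ((IsLinearExtension ℓ ∧ ∀ i j : Fin m, (i : ℕ) + 1 = j →
          (i : ℕ) % 2 = s → (i : ℕ) < k → ℓ.symm i < ℓ.symm j) ∧ ℓ.symm a < ℓ.symm b) ↔
          (IsLinearExtension ℓ ∧ ∀ i j : Fin m, (i : ℕ) + 1 = j →
          (i : ℕ) % 2 = s → (i : ℕ) < k + 1 → ℓ.symm i < ℓ.symm j) := by
        intro ℓ
        constructor
        · rintro ⟨⟨h₁, h₂⟩, h₃⟩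
          refine ⟨h₁, fun i j hij hi hlt => ?_⟩
          by_cases hik : (i : ℕ) = k
          · obtain rfl : i = a := Fin.ext hik
            obtain rfl : j = b := Fin.ext (by omega)
            exact h₃
          · exact h₂ i j hij hi (by omega)
        · rintro ⟨h₁, h₂⟩
          exact ⟨⟨h₁, fun i j hij hi hlt => h₂ i j hij hi (by omega)⟩,
            h₂ a b hab hs (Nat.lt_succ_self k)⟩
      simp only [hpos] at ih
      refine ih.mpr ?_
      rw [← (ZMod.natCast_eq_zero_iff_even), card_eq_sum_ones, Nat.cast_sum]
      refine sum_involution (fun ℓ _ => ℓ.trans (Equiv.swap a b)) ?_ ?_ ?_ ?_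
      · intros
        decide
      · intro ℓ _ _ h
        have := congrArg (fun e : α ≃ Fin m => e (ℓ.symm a)) h
        simp [a, b] at this
      · intro ℓ hℓ
        simp only [mem_filter, mem_univ, true_and] at hℓ ⊢
        obtain ⟨⟨h₁, h₂⟩, h₃⟩ := hℓ
        refine ⟨⟨h₁.trans_swap hab h₃, fun i j hij hi hlt => ?_⟩, ?_⟩
        · have e₁ : Equiv.swap a b i = i := Equiv.swap_apply_of_ne_of_ne
            (by simp only [a, ne_eq, Fin.ext_iff]; omega)
            (by simp only [b, ne_eq, Fin.ext_iff]; omega)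
          have e₂ : Equiv.swap a b j = j := Equiv.swap_apply_of_ne_of_ne
            (by simp only [a, ne_eq, Fin.ext_iff]; omega)
            (by simp only [b, ne_eq, Fin.ext_iff]; omega)
          simpa [e₁, e₂] using h₂ i j hij hi hlt
        · intro hlt
          have hlt' : ℓ.symm b < ℓ.symm a := by simpa using hlt
          have := h₁.lt hlt'
          simp [a, b, Fin.lt_def] at this
      · intro ℓ _
        ext x
        simp
    · convert ih using 4 with ℓ
      constructor
      · exact fun h i j hij hi hlt => h i j hij hi (by omega)
      · exact fun h i j hij hi hlt => h i j hij hi (by have := j.isLt; omega)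

open scoped Classical in
theorem exists_linearExtension_consecutive_lt {m : ℕ} (s : ℕ)
    (hodd : Odd #{ℓ : α ≃ Fin m | IsLinearExtension ℓ}) :
    ∃ ℓ : α ≃ Fin m, IsLinearExtension ℓ ∧
      ∀ i j : Fin m, (i : ℕ) + 1 = j → (i : ℕ) % 2 = s → ℓ.symm i < ℓ.symm j := by
  obtain ⟨ℓ, hℓ⟩ := card_pos.mp (odd_card_consecutive_lt s hodd m).pos
  simp only [mem_filter, mem_univ, true_and] at hℓ
  exact ⟨ℓ, hℓ.1, fun i j hij hi => hℓ.2 i j hij hi i.isLt⟩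

open scoped Classical in
/-- At most a fraction `1 / 2 ^ k` of all orderings respects `k` disjoint pairs. -/
theorem two_pow_mul_card_pairs_le {β : Type*} [Fintype β] {m : ℕ} (e : β ≃ Fin m) (k : ℕ) (hk : 2 * k ≤ m) :
    2 ^ k * #{ℓ : β ≃ Fin m | ∀ i j : Fin m, (i : ℕ) + 1 = j → (i : ℕ) % 2 = 0 →
      (i : ℕ) < 2 * k → ℓ (e.symm i) < ℓ (e.symm j)} ≤ m.factorial := by
  induction k with
  | zero => simp [card_univ, Fintype.card_equiv e, Fintype.card_congr e]
  | succ k ih =>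
    refine le_trans ?_ (ih (by omega))
    rw [pow_succ, mul_assoc]
    refine Nat.mul_le_mul_left _ ?_
    let a : Fin m := ⟨2 * k, by omega⟩
    let b : Fin m := ⟨2 * k + 1, by omega⟩
    rw [← card_filter_add_card_filter_not
      (s := {ℓ : β ≃ Fin m | ∀ i j : Fin m, (i : ℕ) + 1 = j → (i : ℕ) % 2 = 0 →
        (i : ℕ) < 2 * k → ℓ (e.symm i) < ℓ (e.symm j)})
      (fun ℓ : β ≃ Fin m => ℓ (e.symm a) < ℓ (e.symm b)), two_mul]
    refine add_le_add (card_le_card ?_) (card_le_card_of_injOn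
      (fun ℓ => (Equiv.swap (e.symm a) (e.symm b)).trans ℓ) ?_ ?_)
    · intro ℓ hℓ
      simp only [mem_filter, mem_univ, true_and] at hℓ ⊢
      exact ⟨fun i j hij hi hlt => hℓ i j hij hi (by omega),
        hℓ a b rfl (by simp [a]) (by simp [a])⟩
    · intro ℓ hℓ
      simp only [coe_filter, Set.mem_ofPred_eq, mem_filter, mem_univ, true_and] at hℓ ⊢
      refine ⟨fun i j hij hi hlt => ?_, ?_⟩
      · have e₁ : Equiv.swap (e.symm a) (e.symm b) (e.symm i) = e.symm i :=
          Equiv.swap_apply_of_ne_of_ne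
            (by simp only [a, ne_eq, e.symm.injective.eq_iff, Fin.ext_iff]; omega)
            (by simp only [b, ne_eq, e.symm.injective.eq_iff, Fin.ext_iff]; omega)
        have e₂ : Equiv.swap (e.symm a) (e.symm b) (e.symm j) = e.symm j :=
          Equiv.swap_apply_of_ne_of_ne
            (by simp only [a, ne_eq, e.symm.injective.eq_iff, Fin.ext_iff]; omega)
            (by simp only [b, ne_eq, e.symm.injective.eq_iff, Fin.ext_iff]; omega)
        simpa [e₁, e₂] using hℓ i j hij hi (by omega)
      · have := hℓ a b rfl (by simp [a]) (by simp [a])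
        simpa using this.le
    · intro ℓ _ ℓ' _ h
      ext x
      have := congrArg
        (fun f : β ≃ Fin m => f (Equiv.swap (e.symm a) (e.symm b) x)) h
      simp only [Equiv.trans_apply, Equiv.swap_apply_self] at this
      rw [this]

open scoped Classical in
theorem two_pow_mul_card_linearExtension_le {m : ℕ}
    (hodd : Odd #{ℓ : α ≃ Fin m | IsLinearExtension ℓ}) :
    2 ^ (m / 2) * #{ℓ : α ≃ Fin m | IsLinearExtension ℓ} ≤ m.factorial := by
  obtain ⟨e, -, he⟩ := exists_linearExtension_consecutive_lt 0 hodd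
  refine le_trans (Nat.mul_le_mul_left _ (card_le_card ?_))
    (two_pow_mul_card_pairs_le e (m / 2) (by omega))
  intro ℓ hℓ
  simp only [mem_filter, mem_univ, true_and] at hℓ ⊢
  exact fun i j hij hi _ => hℓ.lt (he i j hij hi)

open scoped Classical in
/-- In a poset of height at most 2, listing the minimal elements before all others in any order
is a linear extension. -/
theorem factorial_mul_factorial_le_card_linearExtension {m : ℕ}
    (hm : Fintype.card α = m) (hheight : ¬ ∃ x y z : α, x < y ∧ y < z) :
    (Fintype.card {x : α // ∀ y, ¬ y < x}).factorial *
      (Fintype.card {x : α // ¬ ∀ y, ¬ y < x}).factorial ≤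
      #{ℓ : α ≃ Fin m | IsLinearExtension ℓ} := by
  let p : α → Prop := fun x => ∀ y, ¬ y < x
  let a := Fintype.card {x // p x}
  let b := Fintype.card {x // ¬ p x}
  have hab : a + b = m := by
    rw [← hm, ← Fintype.card_congr (Equiv.sumCompl p), Fintype.card_sum]
  let F : ({x // p x} ≃ Fin a) × ({x // ¬ p x} ≃ Fin b) → (α ≃ Fin m) := fun fg =>
    (Equiv.sumCompl p).symm.trans
      ((Equiv.sumCongr fg.1 fg.2).trans (finSumFinEquiv.trans (finCongr hab)))
  have F₁ : ∀ fg x (hx : p x), (F fg x : ℕ) = fg.1 ⟨x, hx⟩ := by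
    intro fg x hx
    simp [F, Equiv.sumCompl_symm_apply_of_pos hx]
  have F₂ : ∀ fg x (hx : ¬ p x), (F fg x : ℕ) = a + fg.2 ⟨x, hx⟩ := by
    intro fg x hx
    simp [F, Equiv.sumCompl_symm_apply_of_neg hx]
  have hcard : a.factorial * b.factorial =
      #(univ : Finset (({x // p x} ≃ Fin a) × ({x // ¬ p x} ≃ Fin b))) := by
    rw [card_univ, Fintype.card_prod, Fintype.card_equiv (Fintype.equivFin _),
      Fintype.card_equiv (Fintype.equivFin _)]
  change a.factorial * b.factorial ≤ _
  rw [hcard]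
  refine card_le_card_of_injOn F ?_ ?_
  · intro fg _
    simp only [coe_filter, Set.mem_ofPred_eq, mem_univ, true_and]
    intro x y hxy
    rcases hxy.eq_or_lt with rfl | hlt
    · exact le_rfl
    have hx : p x := fun z hz => hheight ⟨z, x, y, hz, hlt⟩
    have hy : ¬ p y := fun h => h x hlt
    rw [Fin.le_def, F₁ fg x hx, F₂ fg y hy]
    have := (fg.1 ⟨x, hx⟩).isLt
    omega
  · intro fg _ fg' _ h
    refine Prod.ext ?_ ?_
    · ext ⟨x, hx⟩
      rw [← F₁ fg x hx, ← F₁ fg' x hx, h]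
    · ext ⟨x, hx⟩
      have := F₂ fg x hx
      rw [h, F₂ fg' x hx] at this
      omega

open scoped Classical in
theorem half_le_card_minimal_and_nonminimal {m : ℕ}
    (hheight : ¬ ∃ x y z : α, x < y ∧ y < z)
    (hodd : Odd #{ℓ : α ≃ Fin m | IsLinearExtension ℓ}) :
    m / 2 ≤ Fintype.card {x : α // ∀ y, ¬ y < x} ∧
      m / 2 ≤ Fintype.card {x : α // ¬ ∀ y, ¬ y < x} := by
  obtain ⟨e, -, he⟩ := exists_linearExtension_consecutive_lt 0 hodd
  let a : Fin (m / 2) → Fin m := fun i => ⟨2 * i, by omega⟩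
  let b : Fin (m / 2) → Fin m := fun i => ⟨2 * i + 1, by omega⟩
  have hlt : ∀ i, e.symm (a i) < e.symm (b i) := fun i => he _ _ rfl (by simp [a])
  constructor
  · simpa using Fintype.card_le_of_injective
      (fun i => (⟨e.symm (a i), fun z hz => hheight ⟨z, _, _, hz, hlt i⟩⟩ :
        {x : α // ∀ y, ¬ y < x}))
      (fun i j h => by simpa [a, Fin.ext_iff] using h)
  · simpa using Fintype.card_le_of_injective
      (fun i => (⟨e.symm (b i), fun h => h _ (hlt i)⟩ : {x : α // ¬ ∀ y, ¬ y < x}))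
      (fun i j h => by simpa [b, Fin.ext_iff] using h)

open scoped Classical in
/-- A poset of height at most 2 on an odd number of elements, with an odd number of linear
extensions, has an isolated element. -/
theorem exists_isolated_of_odd {n : ℕ} (hn : Fintype.card α = 2 * n + 1)
    (hheight : ¬ ∃ x y z : α, x < y ∧ y < z)
    (hodd : Odd #{ℓ : α ≃ Fin (2 * n + 1) | IsLinearExtension ℓ}) :
    ∃ x : α, ∀ y, ¬ x < y ∧ ¬ y < x := by
  by_contra! hiso
  obtain ⟨e, hle, he⟩ := exists_linearExtension_consecutive_lt 0 hodd
  obtain ⟨f, hlf, hf⟩ := exists_linearExtension_consecutive_lt 1 hodd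
  let a : Fin (n + 1) → Fin (2 * n + 1) := fun i => ⟨2 * i - 1, by omega⟩
  let b : Fin (n + 1) → Fin (2 * n + 1) := fun i => ⟨min (2 * i + 1) (2 * n), by omega⟩
  have ha : ∀ i, ∀ y, ¬ y < f.symm (a i) := by
    intro i y hy
    by_cases hi : (i : ℕ) = 0
    · have := hlf.lt hy
      simp [a, hi] at this
    · exact hheight ⟨y, _, _, hy, hf (a i) ⟨2 * i, by omega⟩ (by simp only [a]; omega)
        (by simp only [a]; omega)⟩
  have hb : ∀ i, ¬ ∀ y, ¬ y < e.symm (b i) := by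
    intro i h
    by_cases hi : (i : ℕ) = n
    · obtain ⟨y, hy⟩ := hiso (e.symm (b i))
      by_cases hlt : e.symm (b i) < y
      · have := hle.lt hlt
        rw [Fin.lt_def] at this
        simp only [Equiv.apply_symm_apply, b] at this
        omega
      · exact h y (hy hlt)
    · exact h _ (he ⟨2 * i, by omega⟩ (b i) (by simp only [b]; omega) (by simp))
  have h₁ : n + 1 ≤ Fintype.card {x : α // ∀ y, ¬ y < x} := by
    simpa using Fintype.card_le_of_injective
      (fun i => (⟨f.symm (a i), ha i⟩ : {x : α // ∀ y, ¬ y < x}))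
      (fun i j h => by simp [a, Fin.ext_iff] at h; omega)
  have h₂ : n + 1 ≤ Fintype.card {x : α // ¬ ∀ y, ¬ y < x} := by
    simpa using Fintype.card_le_of_injective
      (fun i => (⟨e.symm (b i), hb i⟩ : {x : α // ¬ ∀ y, ¬ y < x}))
      (fun i j h => by simp [b, Fin.ext_iff] at h; omega)
  have h₃ := Fintype.card_congr (Equiv.sumCompl fun x : α => ∀ y, ¬ y < x)
  rw [Fintype.card_sum, hn] at h₃
  omega

open scoped Classical in
/-- An isolated element is equally likely to occur in each position. -/
theorem dvd_card_linearExtension_of_isolated {m : ℕ} {x : α} (hx : ∀ y, ¬ x < y ∧ ¬ y < x) :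
    m ∣ #{ℓ : α ≃ Fin m | IsLinearExtension ℓ} := by
  let c : Fin m → ℕ := fun i => #{ℓ : α ≃ Fin m | IsLinearExtension ℓ ∧ ℓ x = i}
  have hstep : ∀ i j : Fin m, (i : ℕ) + 1 = j → c i = c j := by
    intro i j hij
    refine card_bij' (fun ℓ _ => ℓ.trans (Equiv.swap i j))
      (fun ℓ _ => ℓ.trans (Equiv.swap i j)) ?_ ?_ ?_ ?_
    · intro ℓ hℓ
      simp only [mem_filter, mem_univ, true_and] at hℓ ⊢
      obtain ⟨h, rfl⟩ := hℓ
      exact ⟨h.trans_swap hij (by simpa using (hx _).1), by simp⟩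
    · intro ℓ hℓ
      simp only [mem_filter, mem_univ, true_and] at hℓ ⊢
      obtain ⟨h, rfl⟩ := hℓ
      exact ⟨h.trans_swap hij (by simpa using (hx _).2), by simp⟩
    · intro ℓ _
      ext y
      simp
    · intro ℓ _
      ext y
      simp
  obtain rfl | hm := m.eq_zero_or_pos
  · have : IsEmpty (α ≃ Fin 0) := ⟨fun e => (e x).elim0⟩
    simp
  have hconst : ∀ k (hk : k < m), c ⟨k, hk⟩ = c ⟨0, hm⟩ := by
    intro k
    induction k with
    | zero => exact fun _ => rfl
    | succ k ih => exact fun hk => (hstep ⟨k, by omega⟩ ⟨k + 1, hk⟩ rfl).symm.trans (ih _)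
  rw [card_eq_sum_card_fiberwise (f := fun ℓ : α ≃ Fin m => ℓ x) (t := univ)
    (fun _ _ => mem_coe.mpr (mem_univ _))]
  simp only [filter_filter]
  change m ∣ ∑ i, c i
  rw [sum_congr rfl fun (i : Fin m) _ => hconst i i.isLt]
  simp

end

/-- There is no height ≤ 2 poset with exactly `(10!)² − 1 = 13168189439999` linear
extensions. -/
theorem no_height2_poset_with_linExt {α : Type*} [Fintype α] [PartialOrder α]
    (hheight : ¬ ∃ x y z : α, x < y ∧ y < z) :
    Nat.card {ℓ : α ≃ Fin (Fintype.card α) // IsLinearExtension ℓ} ≠ 13168189439999 := by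
  classical
  generalize hm : Fintype.card α = m
  intro hcard
  rw [Nat.card_eq_fintype_card, Fintype.card_subtype] at hcard
  have hodd : Odd #{ℓ : α ≃ Fin m | IsLinearExtension ℓ} := by
    rw [hcard]
    decide
  have hupper := two_pow_mul_card_linearExtension_le hodd
  have hlower := factorial_mul_factorial_le_card_linearExtension hm hheight
  obtain ⟨ha, hb⟩ := half_le_card_minimal_and_nonminimal hheight hodd
  rw [hcard] at hupper hlower
  have hm_lt : m < 20 := by
    by_contra! h
    have := (Nat.mul_le_mul (Nat.factorial_le (show 10 ≤ _ by omega))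
      (Nat.factorial_le (show 10 ≤ _ by omega))).trans hlower
    norm_num [Nat.factorial] at this
  obtain rfl | hm_ne := eq_or_ne m 19
  · obtain ⟨x, hx⟩ := exists_isolated_of_odd (n := 9) hm hheight hodd
    have := dvd_card_linearExtension_of_isolated (m := 19) hx
    rw [hcard] at this
    norm_num at this
  · clear * - hupper hm_lt hm_ne
    interval_cases m <;> first | exact hm_ne rfl | norm_num [Nat.factorial] at hupper
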